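/- arXiv:2003.02134 — 3 statements merged into one kernel-verified Lean document; each statement's English description precedes it below -/
import Mathlib

section
/- Let P = {1,…,p} be a finite index set and let M(1), …, M(p) be real n×n matrices each of which is exponentially stable (Hurwitz), i.e. every eigenvalue of each M(i) has negative real part. Then for every dwell time τ_D > 0 and every preassigned convergence rate λ > 0 there exist a positive number g and a constant c ≥ 1 such that for every piecewise-constant switching signal σ : [0,∞) → P whose consecutive discontinuity times are separated by at least τ_D, every differentiable function x : [0,∞) → ℝⁿ satisfying ẋ(t) = g M(σ(t)) x(t) for all t ≥ 0 obeys ‖x(t)‖ ≤ c e^{−λ t} ‖x(0)‖ for all t ≥ 0. -/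
open Set Filter Matrix

/-- The set of points where `σ` is not locally constant (its discontinuity points,
giving the codomain the discrete topology). -/
def Discont {P : Type*} (σ : ℝ → P) : Set ℝ := {s : ℝ | ¬ ∀ᶠ u in nhds s, σ u = σ s}

/-- `σ` is piecewise constant: there is an unbounded increasing sequence of times starting
at `0` such that `σ` is constant on each interval between consecutive times. -/
def PiecewiseConstant {P : Type*} (σ : ℝ → P) : Prop :=
  ∃ T : ℕ → ℝ, T 0 = 0 ∧ StrictMono T ∧ Tendsto T atTop atTop ∧
    ∀ k : ℕ, ∀ s ∈ Set.Ico (T k) (T (k + 1)), σ s = σ (T k)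

/-- `σ` is a piecewise-constant switching signal whose consecutive discontinuity times are
separated by at least `τD`. -/
def HasDwellTime {P : Type*} (τD : ℝ) (σ : ℝ → P) : Prop :=
  PiecewiseConstant σ ∧ ∀ s ∈ Discont σ, ∀ u ∈ Discont σ, s ≠ u → τD ≤ |s - u|

/-- A real square matrix is Hurwitz (exponentially stable) if all of its complex
eigenvalues have negative real part. -/
def Hurwitz {n : ℕ} (M : Matrix (Fin n) (Fin n) ℝ) : Prop :=
  ∀ μ ∈ spectrum ℂ (M.map (algebraMap ℝ ℂ)), μ.re < 0

lemma exp_eigvec {V : Type*} [NormedAddCommGroup V] [NormedSpace ℂ V] [CompleteSpace V]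
    (B : V →L[ℂ] V) (v : V) (μ : ℂ) (h : B v = μ • v) :
    NormedSpace.exp B v = Complex.exp μ • v := by
  have h1 := NormedSpace.exp_series_hasSum_exp' (𝕂 := ℂ) B
  have h2 := h1.mapL (ContinuousLinearMap.apply ℂ V v)
  have h3 := NormedSpace.exp_series_hasSum_exp' (𝕂 := ℂ) μ
  have h4 := h3.smul_const v
  rw [← Complex.exp_eq_exp_ℂ] at h4
  have hp : ∀ n : ℕ, (B ^ n) v = μ ^ n • v := by
    intro n
    induction n with
    | zero => simp
    | succ n ih =>
      rw [pow_succ', mul_apply_eq_comp, ih, map_smul, h, smul_smul, pow_succ]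
  refine h2.unique ?_
  convert h4 using 2 with n
  simp [hp, smul_smul]

lemma exp_spec {V : Type*} [NormedAddCommGroup V] [NormedSpace ℂ V] [FiniteDimensional ℂ V]
    [CompleteSpace V]
    (B : V →L[ℂ] V) (hB : ∀ μ : ℂ, ∀ v : V, v ≠ 0 → B v = μ • v → μ.re < 0) (ν : ℂ)
    (hν : ν ∈ spectrum ℂ (NormedSpace.exp B)) : ‖ν‖ < 1 := by
  rw [ContinuousLinearMap.spectrum_eq, ← Module.End.hasEigenvalue_iff_mem_spectrum] at hν
  set f : Module.End ℂ V := (NormedSpace.exp B : V →L[ℂ] V).toLinearMap with hf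
  have hinv : ∀ x ∈ f.eigenspace ν, B.toLinearMap x ∈ f.eigenspace ν := by
    intro x hx
    rw [Module.End.mem_eigenspace_iff] at hx ⊢
    have hc : Commute (NormedSpace.exp B) B := (Commute.refl B).exp_left
    have := congrArg (fun T : V →L[ℂ] V => T x) hc.eq
    simp only [mul_apply_eq_comp] at this
    change NormedSpace.exp B x = ν • x at hx
    change NormedSpace.exp B (B x) = ν • B x
    rw [this, hx, map_smul]
  have : Nontrivial (f.eigenspace ν) := Submodule.nontrivial_iff_ne_bot.2 hν
  obtain ⟨μ, hμ⟩ := Module.End.exists_eigenvalue (B.toLinearMap.restrict hinv)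
  obtain ⟨w, hw⟩ := hμ.exists_hasEigenvector
  have hw0 : (w : V) ≠ 0 := by simpa using hw.2
  have hw1 : B (w : V) = μ • (w : V) := by
    have := congrArg Subtype.val hw.apply_eq_smul
    simpa using this
  have hre := hB μ w hw0 hw1
  have he := exp_eigvec B w μ hw1
  have he2 : NormedSpace.exp B (w : V) = ν • (w : V) := Module.End.mem_eigenspace_iff.1 w.2
  rw [he] at he2
  have := smul_left_injective ℂ hw0 he2
  rw [← this, Complex.norm_exp]
  simpa using hre

lemma exp_decay {V : Type*} [NormedAddCommGroup V] [NormedSpace ℂ V] [FiniteDimensional ℂ V]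
    [CompleteSpace V]
    (B : V →L[ℂ] V) (hB : ∀ μ : ℂ, ∀ v : V, v ≠ 0 → B v = μ • v → μ.re < 0) :
    ∃ a ≥ (1 : ℝ), ∃ m > (0 : ℝ), ∀ t ≥ (0 : ℝ),
      ‖NormedSpace.exp (t • B)‖ ≤ a * Real.exp (-m * t) := by
  rcases subsingleton_or_nontrivial V with hV | hV
  · refine ⟨1, le_rfl, 1, one_pos, fun t _ => ?_⟩
    have : NormedSpace.exp (t • B) = 0 := by ext v; exact Subsingleton.elim _ _
    rw [this, norm_zero]; positivity
  letI : NormedAlgebra ℚ (V →L[ℂ] V) := NormedAlgebra.restrictScalars ℚ ℂ _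
  have hr : spectralRadius ℂ (NormedSpace.exp B) < (1 : NNReal) := by
    apply spectrum.spectralRadius_lt_of_forall_lt
    intro z hz
    have := exp_spec B hB z hz
    exact_mod_cast this
  have hg := spectrum.pow_nnnorm_pow_one_div_tendsto_nhds_spectralRadius (NormedSpace.exp B)
  obtain ⟨N, hN, hN1⟩ := ((hg.eventually (gt_mem_nhds hr)).and (eventually_ge_atTop 1)).exists
  have hNpos : (0 : ℝ) < N := by exact_mod_cast hN1
  have hq : ‖NormedSpace.exp B ^ N‖ < 1 := by
    by_contra hcon
    push Not at hcon
    have h1 : (1 : ENNReal) ≤ (‖NormedSpace.exp B ^ N‖₊ : ENNReal) := by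
      exact_mod_cast hcon
    have := ENNReal.one_le_rpow h1 (z := (1 / N : ℝ)) (by positivity)
    simp only [ENNReal.coe_one] at hN
    exact absurd hN (not_lt.2 this)
  set q : ℝ := max ‖NormedSpace.exp B ^ N‖ (1/2) with hqdef
  have hq1 : q < 1 := max_lt hq (by norm_num)
  have hq0 : 0 < q := lt_of_lt_of_le (by norm_num) (le_max_right _ _)
  have hcont : Continuous fun t : ℝ => NormedSpace.exp (t • B) :=
    NormedSpace.exp_continuous.comp (continuous_id.smul continuous_const)
  obtain ⟨C, hC⟩ := (isCompact_Icc (a := (0:ℝ)) (b := N)).exists_bound_of_continuousOn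
    hcont.continuousOn
  have hl : Real.log q < 0 := Real.log_neg hq0 hq1
  set C' := max C 1 with hC'
  have hC'1 : 1 ≤ C' := le_max_right _ _
  refine ⟨C' / q, ?_, -Real.log q / N, div_pos (neg_pos.2 hl) hNpos, fun t ht => ?_⟩
  · rw [ge_iff_le, le_div_iff₀ hq0]; linarith
  set k := ⌊t / N⌋₊ with hk
  have hk1 : (k : ℝ) * N ≤ t := by
    have := Nat.floor_le (div_nonneg ht hNpos.le)
    rwa [le_div_iff₀ hNpos] at this
  have hk2 : t / N < k + 1 := Nat.lt_floor_add_one _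
  have hk2' : t < (k + 1) * N := by rwa [div_lt_iff₀ hNpos] at hk2
  have hsplit : NormedSpace.exp (t • B) =
      NormedSpace.exp ((t - k * N) • B) * (NormedSpace.exp B ^ N) ^ k := by
    rw [← pow_mul, ← NormedSpace.exp_nsmul, ← NormedSpace.exp_add_of_commute]
    · congr 1
      rw [← Nat.cast_smul_eq_nsmul ℝ, ← add_smul]
      congr 1
      push_cast; ring
    · exact ((Commute.refl B).smul_right _).smul_left _
  rw [hsplit]
  have h1 : ‖NormedSpace.exp ((t - k * N) • B)‖ ≤ C' :=
    (hC _ ⟨by linarith, by linarith⟩).trans (le_max_left _ _)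
  have h2 : ‖(NormedSpace.exp B ^ N) ^ k‖ ≤ q ^ k :=
    (norm_pow_le _ _).trans (pow_le_pow_left₀ (norm_nonneg _) (le_max_left _ _) _)
  have h3 : q ^ k ≤ q⁻¹ * Real.exp (-(-Real.log q / N) * t) := by
    have : q ^ k = Real.exp (k * Real.log q) := by
      rw [mul_comm, Real.exp_mul, Real.exp_log hq0, Real.rpow_natCast]
    rw [this]
    have : q⁻¹ = Real.exp (- Real.log q) := by rw [Real.exp_neg, Real.exp_log hq0]
    rw [this, ← Real.exp_add, Real.exp_le_exp]
    have e : -(-Real.log q / N) * t = Real.log q * (t / N) := by ring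
    rw [e]
    nlinarith
  calc _ ≤ _ := norm_mul_le _ _
    _ ≤ C' * q ^ k := mul_le_mul h1 h2 (norm_nonneg _) (by linarith)
    _ ≤ C' * (q⁻¹ * Real.exp (-(-Real.log q / N) * t)) := by gcongr
    _ = _ := by ring

lemma ode_decay {V : Type*} [NormedAddCommGroup V] [NormedSpace ℂ V] [CompleteSpace V]
    (B : V →L[ℂ] V) (a m : ℝ)
    (hd : ∀ t ≥ (0 : ℝ), ‖NormedSpace.exp (t • B)‖ ≤ a * Real.exp (-m * t))
    (g : ℝ) (hg : 0 < g) (y : ℝ → V) (s t : ℝ) (hst : s ≤ t)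
    (hyc : ContinuousOn y (Icc s t))
    (hy : ∀ u ∈ Ico s t, HasDerivWithinAt y (g • B (y u)) (Ici u) u) :
    ‖y t‖ ≤ a * Real.exp (-(g * m) * (t - s)) * ‖y s‖ := by
  have hz : ∀ u, HasDerivAt (fun u : ℝ => NormedSpace.exp ((g * (u - s)) • B) (y s))
      (g • B (NormedSpace.exp ((g * (u - s)) • B) (y s))) u := by
    intro u
    have h1 := hasDerivAt_exp_smul_const' (𝕂 := ℝ) B (g * (u - s))
    have h2 : HasDerivAt (fun u : ℝ => g * (u - s)) g u := by
      simpa using ((hasDerivAt_id u).sub_const s).const_mul g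
    have h3 := HasDerivAt.scomp u h1 h2
    have h4 := (((ContinuousLinearMap.apply ℂ V (y s)).restrictScalars ℝ).hasFDerivAt).comp_hasDerivAt u h3
    simpa [Function.comp_def] using h4
  have := ODE_solution_unique_of_mem_Icc_right (v := fun _ w => g • B w) (s := fun _ => univ)
    (K := ‖g • B‖₊) (f := y) (g := fun u : ℝ => NormedSpace.exp ((g * (u - s)) • B) (y s))
    (a := s) (b := t)
    (fun _ _ => (g • B).lipschitz.lipschitzOnWith) hyc hy (fun _ _ => mem_univ _)
    (fun u _ => (hz u).continuousAt.continuousWithinAt)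
    (fun u _ => (hz u).hasDerivWithinAt) (fun _ _ => mem_univ _) (by simp)
  have h := this (right_mem_Icc.2 hst)
  simp only at h
  rw [h]
  refine (ContinuousLinearMap.le_opNorm _ _).trans ?_
  gcongr
  refine (hd _ (by nlinarith)).trans_eq ?_
  congr 2; ring

/-- Complexification of a Euclidean vector. -/
noncomputable def cplx (n : ℕ) : EuclideanSpace ℝ (Fin n) →ₗ[ℝ] (Fin n → ℂ) where
  toFun x := fun i => (x i : ℂ)
  map_add' x y := by ext i; simp
  map_smul' r x := by ext i; simp

lemma cplx_inj (n : ℕ) : LinearMap.ker (cplx n) = ⊥ := by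
  rw [LinearMap.ker_eq_bot]
  intro x y h
  ext i
  have := congrFun h i
  simpa [cplx] using this

lemma cplx_lin {n : ℕ} (A : Matrix (Fin n) (Fin n) ℝ) (x : EuclideanSpace ℝ (Fin n)) :
    cplx n (Matrix.toEuclideanLin A x) =
      LinearMap.toContinuousLinearMap (Matrix.toLin' (A.map (algebraMap ℝ ℂ))) (cplx n x) := by
  ext i
  simp [cplx, Matrix.toEuclideanLin, Matrix.mulVec, dotProduct]

lemma switched {n p : ℕ} (τD lam a m g : ℝ) (ha : 1 ≤ a) (hlam : 0 < lam)
    (hgm : lam ≤ g * m) (hga : a * Real.exp (-(g * m) * τD) ≤ Real.exp (-lam * τD))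
    (σ : ℝ → Fin p) (hσ : HasDwellTime τD σ) (y : ℝ → (Fin n → ℂ))
    (key : ∀ s t, 0 ≤ s → s ≤ t → (∀ u ∈ Ico s t, σ u = σ s) →
      ‖y t‖ ≤ a * Real.exp (-(g * m) * (t - s)) * ‖y s‖) (t : ℝ) (ht : 0 ≤ t) :
    ‖y t‖ ≤ a ^ 2 * Real.exp (-lam * t) * ‖y 0‖ := by
  obtain ⟨⟨T, hT0, hTm, hTt, hTc⟩, hD⟩ := hσ
  have key' : ∀ s t, 0 ≤ s → s ≤ t → (∀ u ∈ Ico s t, σ u = σ s) →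
      ‖y t‖ ≤ a * Real.exp (-lam * (t - s)) * ‖y s‖ := by
    intro s t hs hst h
    refine (key s t hs hst h).trans ?_
    gcongr ?_ * Real.exp ?_ * _
    nlinarith
  have hTnn : ∀ k, 0 ≤ T k := fun k => hT0 ▸ hTm.monotone (Nat.zero_le k)
  have inv : ∀ k, ∃ s, 0 ≤ s ∧ s ≤ T k ∧ (∀ u ∈ Icc s (T k), σ u = σ s) ∧
      ‖y s‖ ≤ a * Real.exp (-lam * s) * ‖y 0‖ ∧ (s = 0 ∨ s ∈ Discont σ) := by
    intro k
    induction k with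
    | zero =>
      refine ⟨0, le_rfl, hT0.ge, ?_, ?_, Or.inl rfl⟩
      · intro u hu
        rw [hT0] at hu
        rw [le_antisymm hu.2 hu.1]
      · simp only [mul_zero, Real.exp_zero, mul_one]
        nlinarith [norm_nonneg (y 0)]
    | succ k ih =>
      obtain ⟨s, hs0, hsT, hsc, hsb, hsd⟩ := ih
      have hlt : T k < T (k + 1) := hTm (Nat.lt_succ_self k)
      have hc : ∀ u ∈ Ico s (T (k + 1)), σ u = σ s := by
        intro u hu
        rcases le_total u (T k) with h | h
        · exact hsc u ⟨hu.1, h⟩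
        · rw [hTc k u ⟨h, hu.2⟩, hsc (T k) ⟨hsT, le_rfl⟩]
      by_cases heq : σ (T (k + 1)) = σ s
      · refine ⟨s, hs0, hsT.trans hlt.le, ?_, hsb, hsd⟩
        intro u hu
        rcases hu.2.lt_or_eq with h | h
        · exact hc u ⟨hu.1, h⟩
        · rw [h, heq]
      · have hdis : T (k + 1) ∈ Discont σ := by
          intro hev
          have hl : ∀ᶠ u in nhdsWithin (T (k + 1)) (Iio (T (k + 1))), σ u = σ (T (k + 1)) :=
            hev.filter_mono nhdsWithin_le_nhds
          have hl2 : ∀ᶠ u in nhdsWithin (T (k + 1)) (Iio (T (k + 1))), u ∈ Ico s (T (k + 1)) :=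
            Ico_mem_nhdsLT (lt_of_le_of_lt hsT hlt)
          obtain ⟨u, hu1, hu2⟩ := (hl.and hl2).exists
          exact heq (hu1.symm.trans (hc u hu2))
        refine ⟨T (k + 1), hTnn _, le_rfl, ?_, ?_, Or.inr hdis⟩
        · intro u hu
          rw [le_antisymm hu.2 hu.1]
        · have hst : s ≤ T (k + 1) := hsT.trans hlt.le
          rcases hsd with h0 | hd
          · subst h0
            simpa using key' 0 _ le_rfl hst hc
          · have hsep := hD s hd _ hdis (lt_of_le_of_lt hsT hlt).ne
            rw [abs_sub_comm, abs_of_nonneg (by linarith)] at hsep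
            have h1 := key s _ hs0 hst hc
            have h2 : a * Real.exp (-(g * m) * (T (k + 1) - s)) ≤
                Real.exp (-lam * (T (k + 1) - s)) := by
              have e1 : Real.exp (-(g * m) * (T (k + 1) - s)) =
                  Real.exp (-(g * m) * τD) * Real.exp (-(g * m) * (T (k + 1) - s - τD)) := by
                rw [← Real.exp_add]; congr 1; ring
              have e2 : Real.exp (-lam * (T (k + 1) - s)) =
                  Real.exp (-lam * τD) * Real.exp (-lam * (T (k + 1) - s - τD)) := by
                rw [← Real.exp_add]; congr 1; ring
              rw [e1, e2, ← mul_assoc]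
              refine mul_le_mul hga ?_ (Real.exp_pos _).le (Real.exp_pos _).le
              rw [Real.exp_le_exp]
              nlinarith
            calc ‖y (T (k + 1))‖ ≤ _ := h1
              _ ≤ Real.exp (-lam * (T (k + 1) - s)) * (a * Real.exp (-lam * s) * ‖y 0‖) := by
                gcongr
              _ = a * (Real.exp (-lam * (T (k + 1) - s)) * Real.exp (-lam * s)) * ‖y 0‖ := by ring
              _ = _ := by
                rw [← Real.exp_add]; congr 3; ring
  obtain ⟨k, hk⟩ : ∃ k, T k ≤ t ∧ t < T (k + 1) := by
    have hex : ∃ k, t < T k := (hTt.eventually_gt_atTop t).exists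
    classical
    have hpos : Nat.find hex ≠ 0 := by
      intro h0
      have := Nat.find_spec hex
      rw [h0, hT0] at this
      linarith
    obtain ⟨j, hj⟩ := Nat.exists_eq_succ_of_ne_zero hpos
    refine ⟨j, ?_, ?_⟩
    · exact not_lt.1 (Nat.find_min hex (by omega))
    · have := Nat.find_spec hex
      rwa [hj] at this
  obtain ⟨s, hs0, hsT, hsc, hsb, -⟩ := inv k
  have hc : ∀ u ∈ Ico s t, σ u = σ s := by
    intro u hu
    rcases le_total u (T k) with h | h
    · exact hsc u ⟨hu.1, h⟩
    · rw [hTc k u ⟨h, hu.2.trans hk.2⟩, hsc (T k) ⟨hsT, le_rfl⟩]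
  calc ‖y t‖ ≤ _ := key' s t hs0 (hsT.trans hk.1) hc
    _ ≤ a * Real.exp (-lam * (t - s)) * (a * Real.exp (-lam * s) * ‖y 0‖) := by gcongr
    _ = a ^ 2 * (Real.exp (-lam * (t - s)) * Real.exp (-lam * s)) * ‖y 0‖ := by ring
    _ = _ := by
      rw [← Real.exp_add]; congr 3; ring

/-- Lemma 1: for a finite family of Hurwitz matrices, any dwell time `τD > 0` and any
preassigned rate `λ > 0`, there is a gain `g > 0` such that all solutions of the switched
system `ẋ = g M(σ(t)) x` decay at rate `λ`. -/
theorem lemma1_dwell_time_high_gain_stability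
    {n p : ℕ} (hp : 1 ≤ p) (M : Fin p → Matrix (Fin n) (Fin n) ℝ)
    (hM : ∀ i, Hurwitz (M i)) :
    ∀ τD > (0 : ℝ), ∀ lam > (0 : ℝ), ∃ g > (0 : ℝ), ∃ c ≥ (1 : ℝ),
      ∀ σ : ℝ → Fin p, HasDwellTime τD σ →
        ∀ x : ℝ → EuclideanSpace ℝ (Fin n),
          (∀ t ∈ Set.Ici (0 : ℝ),
            HasDerivWithinAt x (g • Matrix.toEuclideanLin (M (σ t)) (x t)) (Set.Ici 0) t) →
          ∀ t ≥ (0 : ℝ), ‖x t‖ ≤ c * Real.exp (-lam * t) * ‖x 0‖ := by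
  intro τD hτ lam hlam
  let B : Fin p → ((Fin n → ℂ) →L[ℂ] (Fin n → ℂ)) := fun i =>
    LinearMap.toContinuousLinearMap (Matrix.toLin' ((M i).map (algebraMap ℝ ℂ)))
  have hB : ∀ i, ∃ a ≥ (1 : ℝ), ∃ m > (0 : ℝ), ∀ t ≥ (0 : ℝ),
      ‖NormedSpace.exp (t • B i)‖ ≤ a * Real.exp (-m * t) := by
    intro i
    refine exp_decay (B i) fun μ v hv h => hM i μ ?_
    rw [← Matrix.spectrum_toLin', ← Module.End.hasEigenvalue_iff_mem_spectrum]
    exact Module.End.hasEigenvalue_of_hasEigenvector (x := v)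
      ⟨Module.End.mem_eigenspace_iff.2 h, hv⟩
  choose a ha m hm hd using hB
  have : Nonempty (Fin p) := ⟨⟨0, hp⟩⟩
  obtain ⟨ia, hia⟩ := Finite.exists_max a
  obtain ⟨im, him⟩ := Finite.exists_min m
  set a' := a ia with ha'
  set m' := m im with hm'
  have ha1 : 1 ≤ a' := ha ia
  have hm0 : 0 < m' := hm im
  have hd' : ∀ i, ∀ t ≥ (0 : ℝ), ‖NormedSpace.exp (t • B i)‖ ≤ a' * Real.exp (-m' * t) := by
    intro i t ht
    refine (hd i t ht).trans ?_
    have := him i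
    gcongr
    exact hia i
  have hloga : 0 ≤ Real.log a' := Real.log_nonneg ha1
  set g : ℝ := (lam + Real.log a' / τD) / m' with hg
  have hgm : g * m' = lam + Real.log a' / τD := by rw [hg]; field_simp
  have hg0 : 0 < g := by rw [hg]; positivity
  have hgl : lam ≤ g * m' := by
    rw [hgm]; have : 0 ≤ Real.log a' / τD := by positivity
    linarith
  have hga : a' * Real.exp (-(g * m') * τD) ≤ Real.exp (-lam * τD) := by
    rw [hgm]
    have e : -(lam + Real.log a' / τD) * τD = -lam * τD - Real.log a' := by field_simp; ring
    rw [e, Real.exp_sub, Real.exp_log (by linarith)]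
    apply le_of_eq
    field_simp
  obtain ⟨K, hK0, hK⟩ := LinearMap.exists_antilipschitzWith (cplx n) (cplx_inj n)
  let J : EuclideanSpace ℝ (Fin n) →L[ℝ] (Fin n → ℂ) := LinearMap.toContinuousLinearMap (cplx n)
  refine ⟨g, hg0, max 1 (K * a' ^ 2 * ‖J‖), le_max_left _ _, ?_⟩
  intro σ hσ x hx t ht
  have hJ : ∀ u ∈ Ici (0 : ℝ),
      HasDerivWithinAt (fun u => J (x u)) (g • B (σ u) (J (x u))) (Ici 0) u := by
    intro u hu
    have h1 := J.hasFDerivAt.comp_hasDerivWithinAt u (hx u hu)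
    have h2 : J (g • Matrix.toEuclideanLin (M (σ u)) (x u)) = g • B (σ u) (J (x u)) := by
      rw [map_smul]
      congr 1
      exact cplx_lin (M (σ u)) (x u)
    rw [h2] at h1
    exact h1
  have hfin := switched τD lam a' m' g ha1 hlam hgl hga σ hσ (fun u => J (x u)) ?_ t ht
  · have hKx : ‖x t‖ ≤ K * ‖J (x t)‖ := by
      have := hK.le_mul_dist (x t) 0
      simpa [J] using this
    calc ‖x t‖ ≤ K * ‖J (x t)‖ := hKx
      _ ≤ K * (a' ^ 2 * Real.exp (-lam * t) * (‖J‖ * ‖x 0‖)) := by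
        gcongr
        refine hfin.trans ?_
        gcongr
        exact J.le_opNorm _
      _ = (K * a' ^ 2 * ‖J‖) * Real.exp (-lam * t) * ‖x 0‖ := by ring
      _ ≤ _ := by
        gcongr
        exact le_max_right _ _
  · intro s r hs hsr hc
    refine ode_decay (B (σ s)) a' m' (hd' (σ s)) g hg0 (fun u => J (x u)) s r hsr ?_ ?_
    · intro u hu
      exact (hJ u (hs.trans hu.1)).continuousWithinAt.mono fun w hw => hs.trans hw.1
    · intro u hu
      have := (hJ u (hs.trans hu.1)).mono (Ici_subset_Ici.2 (hs.trans hu.1))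
      rwa [hc u hu] at this
end

section
/- Let P = {1,…,p} be a finite index set, let M(1), …, M(p) be real n×n matrices each of which is exponentially stable (Hurwitz), and let N be a fixed real n×n matrix. Then for every dwell time τ_D > 0 and every preassigned convergence rate λ > 0 there exist a positive number g and a constant c ≥ 1 such that for every piecewise-constant switching signal σ : [0,∞) → P whose consecutive discontinuity times are separated by at least τ_D, every differentiable function x : [0,∞) → ℝⁿ satisfying ẋ(t) = ( N + g M(σ(t)) ) x(t) for all t ≥ 0 obeys ‖x(t)‖ ≤ c e^{−λ t} ‖x(0)‖ for all t ≥ 0. -/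
open Set Filter Matrix

section Gelfand

theorem exists_pow_bound {A : Type*} [NormedRing A] [NormedAlgebra ℂ A] [CompleteSpace A]
    (a : A) (h : ∀ z ∈ spectrum ℂ a, ‖z‖ < 1) :
    ∃ r : ℝ, 0 ≤ r ∧ r < 1 ∧ ∀ᶠ k : ℕ in atTop, ‖a ^ k‖ ≤ r ^ k := by
  rcases subsingleton_or_nontrivial A with hA | hA
  · refine ⟨0, le_rfl, one_pos, Eventually.of_forall fun k => ?_⟩
    rw [Subsingleton.elim (a ^ k) 0, norm_zero]
    positivity
  · have h1 : spectralRadius ℂ a < ((1 : NNReal) : ENNReal) := by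
      apply spectrum.spectralRadius_lt_of_forall_lt
      intro z hz
      exact_mod_cast h z hz
    obtain ⟨r, hr1, hr2⟩ := ENNReal.lt_iff_exists_nnreal_btwn.1 h1
    have hr3 : r < 1 := by exact_mod_cast hr2
    refine ⟨r, r.2, by exact_mod_cast hr3, ?_⟩
    have := (spectrum.pow_nnnorm_pow_one_div_tendsto_nhds_spectralRadius a).eventually_lt_const hr1
    filter_upwards [this, eventually_gt_atTop 0] with k hk hk0
    have hk' : (0 : ℝ) < k := by exact_mod_cast hk0
    have h2 := ENNReal.rpow_le_rpow hk.le hk'.le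
    rw [← ENNReal.rpow_mul, one_div, inv_mul_cancel₀ hk'.ne', ENNReal.rpow_one,
      ENNReal.rpow_natCast] at h2
    have h3 : ‖a ^ k‖₊ ≤ r ^ k := by exact_mod_cast h2
    exact_mod_cast h3

theorem exists_lin_bound {V W : Type*} [NormedAddCommGroup V] [NormedSpace ℝ V]
    [FiniteDimensional ℝ V] [NormedAddCommGroup W] [NormedSpace ℝ W] (f : V →ₗ[ℝ] W) :
    ∃ L : ℝ, 0 ≤ L ∧ ∀ v, ‖f v‖ ≤ L * ‖v‖ :=
  ⟨‖LinearMap.toContinuousLinearMap f‖, norm_nonneg _,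
    fun v => (LinearMap.toContinuousLinearMap f).le_opNorm v⟩

theorem cayley_spectrum {A : Type*} [Ring A] [Algebra ℂ A] (m s : A)
    (h1 : (1 - m) * s = 1) (h2 : s * (1 - m) = 1)
    (hm : ∀ μ ∈ spectrum ℂ m, μ.re < 0) :
    ∀ z ∈ spectrum ℂ ((1 + m) * s), ‖z‖ < 1 := by
  intro z hz
  by_contra hcon
  push Not at hcon
  rw [spectrum.mem_iff] at hz
  apply hz
  have hs : IsUnit s := ⟨⟨s, 1 - m, h2, h1⟩, rfl⟩
  have e : algebraMap ℂ A z - (1 + m) * s = (algebraMap ℂ A z * (1 - m) - (1 + m)) * s := by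
    rw [sub_mul, mul_assoc, h1, mul_one]
  rw [e]
  apply IsUnit.mul _ hs
  by_cases hz1 : z = -1
  · have : algebraMap ℂ A z * (1 - m) - (1 + m) = algebraMap ℂ A (-2) := by
      rw [hz1]
      rw [show (-2 : ℂ) = -1 + -1 by norm_num]
      simp only [map_add, map_neg, map_one]
      noncomm_ring
    rw [this]
    exact (IsUnit.mk0 (-2 : ℂ) (by norm_num)).map (algebraMap ℂ A)
  · have hz2 : z + 1 ≠ 0 := fun hh => hz1 (eq_neg_of_add_eq_zero_left hh)
    have : algebraMap ℂ A z * (1 - m) - (1 + m)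
        = algebraMap ℂ A (z + 1) * (algebraMap ℂ A ((z - 1) / (z + 1)) - m) := by
      rw [mul_sub (algebraMap ℂ A (z + 1)), ← map_mul, mul_div_cancel₀ _ hz2]
      simp only [map_add, map_sub, map_one]
      noncomm_ring
    rw [this]
    apply IsUnit.mul ((IsUnit.mk0 _ hz2).map (algebraMap ℂ A))
    by_contra hn
    have h3 := hm _ (spectrum.mem_iff.2 hn)
    rw [Complex.div_re, ← add_div] at h3
    have h4 : 0 < Complex.normSq (z + 1) := Complex.normSq_pos.2 hz2
    rw [div_lt_iff₀ h4, zero_mul] at h3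
    have h5 : 1 ≤ Complex.normSq z := by
      rw [Complex.normSq_eq_norm_sq]; nlinarith
    rw [Complex.normSq_apply] at h5
    simp at h3
    nlinarith

open scoped Matrix.Norms.Frobenius in
theorem hurwitz_cayley {n : ℕ} (M : Matrix (Fin n) (Fin n) ℝ) (hM : Hurwitz M) :
    ∃ S : Matrix (Fin n) (Fin n) ℝ, (1 - M) * S = 1 ∧ S * (1 - M) = 1 ∧
      Summable fun k : ℕ =>
        ‖(Matrix.toEuclideanCLM (n := Fin n) (𝕜 := ℝ) ((1 + M) * S)) ^ k‖ ^ 2 := by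
  set φ := (algebraMap ℝ ℂ).mapMatrix (m := Fin n) with hφ
  have hu : IsUnit (1 - M).det := by
    have h1 : IsUnit (algebraMap ℂ (Matrix (Fin n) (Fin n) ℂ) 1 - φ M) := by
      by_contra hn
      have := hM 1 (spectrum.mem_iff.2 hn)
      norm_num at this
    rw [map_one, ← map_one φ, ← map_sub, Matrix.isUnit_iff_isUnit_det, ← RingHom.map_det] at h1
    rw [isUnit_iff_ne_zero] at h1 ⊢
    intro h0
    rw [h0] at h1
    simp at h1
  refine ⟨(1 - M)⁻¹, Matrix.mul_nonsing_inv _ hu, Matrix.nonsing_inv_mul _ hu, ?_⟩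
  set S := (1 - M)⁻¹ with hS
  have h1 : (1 - φ M) * φ S = 1 := by
    rw [← map_one φ, ← map_sub, ← map_mul, Matrix.mul_nonsing_inv _ hu]
  have h2 : φ S * (1 - φ M) = 1 := by
    rw [← map_one φ, ← map_sub, ← map_mul, Matrix.nonsing_inv_mul _ hu]
  obtain ⟨r, hr0, hr1, hr⟩ := exists_pow_bound _ (cayley_spectrum (φ M) (φ S) h1 h2 hM)
  set B := (1 + M) * S with hB
  have hBk : ∀ k, ‖((1 + φ M) * φ S) ^ k‖ = ‖B ^ k‖ := by
    intro k
    rw [← map_one φ, ← map_add, ← map_mul, ← map_pow]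
    exact Matrix.frobenius_norm_map_eq _ _ (fun a => by simp)
  obtain ⟨L, hL0, hL⟩ := exists_lin_bound
    ((Matrix.toEuclideanCLM (n := Fin n) (𝕜 := ℝ)).toAlgEquiv.toLinearMap)
  replace hL : ∀ X, ‖Matrix.toEuclideanCLM (n := Fin n) (𝕜 := ℝ) X‖ ≤ L * ‖X‖ := fun X => hL X
  have hsum : Summable fun k : ℕ => L ^ 2 * (r ^ 2) ^ k :=
    (summable_geometric_of_lt_one (by positivity) (by nlinarith)).mul_left _
  refine hsum.of_norm_bounded_eventually_nat ?_
  filter_upwards [hr] with k hk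
  rw [hBk] at hk
  rw [← map_pow, Real.norm_of_nonneg (by positivity), ← pow_mul, mul_comm 2 k, pow_mul, ← mul_pow]
  gcongr
  exact (hL _).trans (by gcongr)

end Gelfand

section Lyap

open scoped RealInnerProductSpace

variable {E : Type*} [NormedAddCommGroup E] [InnerProductSpace ℝ E] [CompleteSpace E]

theorem lyap_abstract (T S : E →L[ℝ] E) (h1 : (1 - T) * S = 1) (h2 : S * (1 - T) = 1)
    (hs : Summable fun k : ℕ => ‖((1 + T) * S) ^ k‖ ^ 2) :
    ∃ (Q : E →L[ℝ] E) (c : ℝ), 0 < c ∧ (∀ x y, ⟪Q x, y⟫ = ⟪x, Q y⟫) ∧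
      (∀ x, ‖x‖ ^ 2 ≤ ⟪Q x, x⟫) ∧ ∀ x, ⟪Q x, T x⟫ ≤ - c * ‖x‖ ^ 2 := by
  set B := (1 + T) * S with hB
  have hsum : Summable fun k : ℕ => star (B ^ k) * B ^ k := by
    refine Summable.of_norm_bounded hs fun k => ?_
    refine (norm_mul_le _ _).trans ?_
    rw [ContinuousLinearMap.star_eq_adjoint, LinearIsometryEquiv.norm_map, sq]
  set Q : E →L[ℝ] E := ∑' k : ℕ, star (B ^ k) * B ^ k with hQ
  have hin : ∀ x y, HasSum (fun k : ℕ => ⟪(B ^ k) x, (B ^ k) y⟫) ⟪Q x, y⟫ := by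
    intro x y
    have h := hsum.hasSum.mapL ((innerSL ℝ y).comp (ContinuousLinearMap.apply ℝ E x))
    simp only [ContinuousLinearMap.comp_apply, ContinuousLinearMap.apply_apply,
      innerSL_apply_apply] at h
    rw [real_inner_comm]
    have e : (fun k : ℕ => ⟪(B ^ k) x, (B ^ k) y⟫)
        = fun k : ℕ => ⟪y, (star (B ^ k) * B ^ k) x⟫ := by
      funext k
      rw [mul_apply_eq_comp, ContinuousLinearMap.star_eq_adjoint]
      change _ = ⟪y, (ContinuousLinearMap.adjoint (B ^ k)) ((B ^ k) x)⟫
      rw [ContinuousLinearMap.adjoint_inner_right, real_inner_comm]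
    rw [e]
    exact h
  have hsymm : ∀ x y, ⟪Q x, y⟫ = ⟪x, Q y⟫ := by
    intro x y
    rw [real_inner_comm (Q y) x]
    refine (hin x y).unique ?_
    convert hin y x using 2 with k
    rw [real_inner_comm]
  have hstein : ∀ x, ⟪Q x, x⟫ = ‖x‖ ^ 2 + ⟪Q (B x), B x⟫ := by
    intro x
    have ha := (hasSum_nat_add_iff' 1).2 (hin x x)
    have hb := hin (B x) (B x)
    have : (fun k : ℕ => ⟪(B ^ (k + 1)) x, (B ^ (k + 1)) x⟫)
        = fun k : ℕ => ⟪(B ^ k) (B x), (B ^ k) (B x)⟫ := by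
      funext k
      rw [pow_succ, mul_apply_eq_comp]
    rw [this] at ha
    have := ha.unique hb
    simp at this
    linarith
  have hnn : ∀ x, 0 ≤ ⟪Q x, x⟫ := fun x =>
    (hin x x).nonneg fun k => real_inner_self_nonneg
  refine ⟨Q, (4 * (‖S‖ + 1) ^ 2)⁻¹, by positivity, hsymm, fun x => ?_, fun x => ?_⟩
  · rw [hstein x]
    linarith [hnn (B x)]
  · have hSx : S (x - T x) = x := by
      have := congrArg (fun F : E →L[ℝ] E => F x) h2
      simpa using this
    have hBx : B (x - T x) = x + T x := by
      rw [hB, mul_apply_eq_comp, hSx]; simp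
    have h3 := hstein (x - T x)
    rw [hBx] at h3
    simp only [map_sub, map_add, inner_sub_left, inner_sub_right, inner_add_left,
      inner_add_right] at h3
    have h4 : ⟪Q (T x), x⟫ = ⟪Q x, T x⟫ := by
      rw [hsymm, real_inner_comm]
    have h5 : ‖x‖ ≤ (‖S‖ + 1) * ‖x - T x‖ := by
      calc ‖x‖ = ‖S (x - T x)‖ := by rw [hSx]
        _ ≤ ‖S‖ * ‖x - T x‖ := S.le_opNorm _
        _ ≤ _ := by gcongr; linarith
    have h6 : ‖x‖ ^ 2 ≤ (‖S‖ + 1) ^ 2 * ‖x - T x‖ ^ 2 := by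
      rw [← mul_pow]; gcongr
    have h7 : (4 * (‖S‖ + 1) ^ 2)⁻¹ * ‖x‖ ^ 2 ≤ ‖x - T x‖ ^ 2 / 4 := by
      rw [inv_mul_le_iff₀ (by positivity)]
      linarith
    linarith

theorem decay_interval (Q A : E →L[ℝ] E) (ρ : ℝ)
    (hsymm : ∀ x y, ⟪Q x, y⟫ = ⟪x, Q y⟫)
    (hA : ∀ x, ⟪Q x, A x⟫ ≤ - ρ * ⟪Q x, x⟫) (x : ℝ → E) (a b : ℝ) (hab : a ≤ b)
    (hc : ContinuousOn x (Icc a b)) (hx : ∀ t ∈ Ioo a b, HasDerivAt x (A (x t)) t) :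
    ⟪Q (x b), x b⟫ ≤ Real.exp (-(2 * ρ * (b - a))) * ⟪Q (x a), x a⟫ := by
  have hanti : AntitoneOn (fun t => Real.exp (2 * ρ * t) * ⟪Q (x t), x t⟫) (Icc a b) := by
    have hd : ∀ t ∈ Ioo a b, HasDerivAt (fun t => Real.exp (2 * ρ * t) * ⟪Q (x t), x t⟫)
        (Real.exp (2 * ρ * t) * (2 * ρ) * ⟪Q (x t), x t⟫ +
          Real.exp (2 * ρ * t) * (⟪Q (x t), A (x t)⟫ + ⟪Q (A (x t)), x t⟫)) t := by
      intro t ht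
      have h1 : HasDerivAt (fun t => Real.exp (2 * ρ * t)) (Real.exp (2 * ρ * t) * (2 * ρ)) t := by
        have := ((hasDerivAt_id t).const_mul (2 * ρ)).exp
        simpa using this
      have h2 : HasDerivAt (fun t => Q (x t)) (Q (A (x t))) t :=
        Q.hasFDerivAt.comp_hasDerivAt t (hx t ht)
      exact h1.mul (h2.inner ℝ (hx t ht))
    apply antitoneOn_of_deriv_nonpos (convex_Icc a b)
    · apply ContinuousOn.mul (by fun_prop)
      exact (Q.continuous.comp_continuousOn hc).inner hc
    · rw [interior_Icc]
      intro t ht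
      exact (hd t ht).differentiableAt.differentiableWithinAt
    · rw [interior_Icc]
      intro t ht
      rw [(hd t ht).deriv]
      have h3 : ⟪Q (A (x t)), x t⟫ = ⟪Q (x t), A (x t)⟫ := by
        rw [hsymm, real_inner_comm]
      rw [h3]
      have h4 := hA (x t)
      have h5 := Real.exp_pos (2 * ρ * t)
      nlinarith
  have := hanti (left_mem_Icc.2 hab) (right_mem_Icc.2 hab) hab
  simp only at this
  have e : -(2 * ρ * (b - a)) = - (2 * ρ * b) + 2 * ρ * a := by ring
  rw [e, Real.exp_add, mul_assoc, Real.exp_neg, le_inv_mul_iff₀ (Real.exp_pos _)]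
  exact this

end Lyap

section Final

open scoped RealInnerProductSpace

theorem chaining {P : Type*} {E : Type*} [NormedAddCommGroup E] (τD lam ρ C : ℝ)
    (hτ : 0 < τD) (hC : 1 ≤ C) (hρ : lam ≤ ρ)
    (hCρ : C * Real.exp (-ρ * τD) ≤ Real.exp (-lam * τD))
    (σ : ℝ → P) (hσ : HasDwellTime τD σ) (x : ℝ → E)
    (hx : ∀ a b, 0 ≤ a → a ≤ b → (∀ u ∈ Ico a b, σ u = σ a) →
      ‖x b‖ ≤ C * Real.exp (-ρ * (b - a)) * ‖x a‖) :
    ∀ t ≥ (0 : ℝ), ‖x t‖ ≤ C ^ 2 * Real.exp (-lam * t) * ‖x 0‖ := by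
  obtain ⟨⟨T, hT0, hTm, hTt, hTc⟩, hdw⟩ := hσ
  have hTnn : ∀ k, 0 ≤ T k := fun k => hT0 ▸ hTm.monotone (Nat.zero_le k)
  have key : ∀ k : ℕ, ∃ s, 0 ≤ s ∧ s ≤ T k ∧ (∀ u ∈ Icc s (T k), σ u = σ s) ∧
      (s = 0 ∨ s ∈ Discont σ) ∧ ‖x s‖ ≤ C * Real.exp (-lam * s) * ‖x 0‖ := by
    intro k
    induction k with
    | zero =>
      refine ⟨0, le_rfl, hT0.ge, ?_, Or.inl rfl, ?_⟩
      · intro u hu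
        rw [hT0] at hu
        rw [le_antisymm hu.2 hu.1]
      · simp only [mul_zero, Real.exp_zero, mul_one]
        exact le_mul_of_one_le_left (norm_nonneg _) hC
    | succ k ih =>
      obtain ⟨s, hs0, hsk, hsc, hsd, hsx⟩ := ih
      have hlt : T k < T (k + 1) := hTm (Nat.lt_succ_self k)
      have hcon : ∀ u ∈ Ico s (T (k + 1)), σ u = σ s := by
        intro u hu
        rcases le_total u (T k) with h | h
        · exact hsc u ⟨hu.1, h⟩
        · rw [hTc k u ⟨h, hu.2⟩]
          exact hsc _ ⟨hsk, le_rfl⟩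
      by_cases he : σ (T (k + 1)) = σ s
      · refine ⟨s, hs0, hsk.trans hlt.le, ?_, hsd, hsx⟩
        intro u hu
        rcases hu.2.eq_or_lt with h | h
        · rw [h, he]
        · exact hcon u ⟨hu.1, h⟩
      · have hsl : s < T (k + 1) := hsk.trans_lt hlt
        have hD : T (k + 1) ∈ Discont σ := by
          intro hev
          obtain ⟨l, hl, hl2⟩ := (eventually_nhdsWithin_of_eventually_nhds hev
            (s := Iio (T (k + 1)))).and (Ico_mem_nhdsLT hsl) |>.exists
          exact he (hl.symm.trans (hcon l hl2))
        refine ⟨T (k + 1), hTnn _, le_rfl, ?_, Or.inr hD, ?_⟩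
        · intro u hu
          rw [le_antisymm hu.2 hu.1]
        · have hb := hx s (T (k + 1)) hs0 hsl.le hcon
          rcases hsd with h0 | hd
          · subst h0
            refine hb.trans ?_
            rw [sub_zero]
            gcongr
          · have hτs : τD ≤ T (k + 1) - s := by
              have := hdw _ hD _ hd hsl.ne'
              rwa [abs_of_pos (by linarith)] at this
            have h1 : C * Real.exp (-ρ * (T (k + 1) - s))
                ≤ Real.exp (-lam * (T (k + 1) - s)) := by
              have e1 : -ρ * (T (k + 1) - s) = -ρ * τD + -ρ * (T (k + 1) - s - τD) := by ring
              have e2 : -lam * (T (k + 1) - s) = -lam * τD + -lam * (T (k + 1) - s - τD) := by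
                ring
              rw [e1, e2, Real.exp_add, Real.exp_add, ← mul_assoc]
              apply mul_le_mul hCρ _ (Real.exp_pos _).le (Real.exp_pos _).le
              apply Real.exp_le_exp.2
              nlinarith
            calc ‖x (T (k + 1))‖ ≤ C * Real.exp (-ρ * (T (k + 1) - s)) * ‖x s‖ := hb
              _ ≤ Real.exp (-lam * (T (k + 1) - s)) * (C * Real.exp (-lam * s) * ‖x 0‖) := by
                  gcongr
              _ = C * (Real.exp (-lam * (T (k + 1) - s)) * Real.exp (-lam * s)) * ‖x 0‖ := by
                  ring
              _ = _ := by
                  rw [← Real.exp_add]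
                  congr 3
                  ring
  intro t ht
  obtain ⟨k, hk1, hk2⟩ : ∃ k, T k ≤ t ∧ t < T (k + 1) := by
    have hex : ∃ m, t < T m := (hTt.eventually_gt_atTop t).exists
    classical
    have hpos : Nat.find hex ≠ 0 := by
      intro h0
      have := Nat.find_spec hex
      rw [h0, hT0] at this
      linarith
    obtain ⟨j, hj⟩ := Nat.exists_eq_succ_of_ne_zero hpos
    refine ⟨j, ?_, ?_⟩
    · exact not_lt.1 (Nat.find_min hex (by omega))
    · have := Nat.find_spec hex
      rwa [hj] at this
  obtain ⟨s, hs0, hsk, hsc, -, hsx⟩ := key k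
  have hcon : ∀ u ∈ Ico s t, σ u = σ s := by
    intro u hu
    rcases le_total u (T k) with h | h
    · exact hsc u ⟨hu.1, h⟩
    · rw [hTc k u ⟨h, hu.2.trans hk2⟩]
      exact hsc _ ⟨hsk, le_rfl⟩
  have hst : s ≤ t := hsk.trans hk1
  calc ‖x t‖ ≤ C * Real.exp (-ρ * (t - s)) * ‖x s‖ := hx s t hs0 hst hcon
    _ ≤ C * Real.exp (-lam * (t - s)) * (C * Real.exp (-lam * s) * ‖x 0‖) := by
        gcongr
    _ = C ^ 2 * (Real.exp (-lam * (t - s)) * Real.exp (-lam * s)) * ‖x 0‖ := by ring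
    _ = _ := by
        rw [← Real.exp_add]
        congr 3
        ring

end Final

/-- Lemma 2: dwell-time switching of a high-gain Hurwitz family perturbed by a fixed
matrix `N`: for any `τD > 0` and `λ > 0` there is a gain `g > 0` such that all solutions of
`ẋ = (N + g M(σ(t))) x` decay at rate `λ`. -/
theorem lemma2_dwell_time_high_gain_perturbed_stability
    {n p : ℕ} (hp : 1 ≤ p) (M : Fin p → Matrix (Fin n) (Fin n) ℝ)
    (hM : ∀ i, Hurwitz (M i)) (N : Matrix (Fin n) (Fin n) ℝ) :
    ∀ τD > (0 : ℝ), ∀ lam > (0 : ℝ), ∃ g > (0 : ℝ), ∃ c ≥ (1 : ℝ),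
      ∀ σ : ℝ → Fin p, HasDwellTime τD σ →
        ∀ x : ℝ → EuclideanSpace ℝ (Fin n),
          (∀ t ∈ Set.Ici (0 : ℝ),
            HasDerivWithinAt x
              (Matrix.toEuclideanLin N (x t) + g • Matrix.toEuclideanLin (M (σ t)) (x t))
              (Set.Ici 0) t) →
          ∀ t ≥ (0 : ℝ), ‖x t‖ ≤ c * Real.exp (-lam * t) * ‖x 0‖ := by
  intro τD hτ lam hlam
  let φ := Matrix.toEuclideanCLM (n := Fin n) (𝕜 := ℝ)
  have hly : ∀ i, ∃ (Q : EuclideanSpace ℝ (Fin n) →L[ℝ] EuclideanSpace ℝ (Fin n)) (c : ℝ),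
      0 < c ∧ (∀ x y, inner ℝ (Q x) y = inner ℝ x (Q y)) ∧
      (∀ x, ‖x‖ ^ 2 ≤ inner ℝ (Q x) x) ∧ ∀ x, inner ℝ (Q x) (φ (M i) x) ≤ - c * ‖x‖ ^ 2 := by
    intro i
    obtain ⟨S, h1, h2, h3⟩ := hurwitz_cayley (M i) (hM i)
    apply lyap_abstract (φ (M i)) (φ S)
    · rw [← map_one φ, ← map_sub, ← map_mul, h1]
    · rw [← map_one φ, ← map_sub, ← map_mul, h2]
    · rw [← map_one φ, ← map_add, ← map_mul]
      exact h3
  choose Q c hc hsymm hlow hneg using hly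
  set C : ℝ := 1 + ∑ i, ‖Q i‖ with hC
  have hC1 : 1 ≤ C := by
    have : 0 ≤ ∑ i, ‖Q i‖ := Finset.sum_nonneg fun i _ => norm_nonneg _
    linarith
  have hQC : ∀ i, ‖Q i‖ ≤ C := fun i => by
    have := Finset.single_le_sum (f := fun i => ‖Q i‖) (fun i _ => norm_nonneg _)
      (Finset.mem_univ i)
    linarith
  set ρ : ℝ := lam + Real.log C / τD with hρ
  have hlog : 0 ≤ Real.log C / τD := div_nonneg (Real.log_nonneg hC1) hτ.le
  set g : ℝ := 1 + ∑ i, ‖Q i‖ * (‖φ N‖ + ρ) / c i with hg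
  have hterm : ∀ i, 0 ≤ ‖Q i‖ * (‖φ N‖ + ρ) / c i := fun i =>
    div_nonneg (mul_nonneg (norm_nonneg _) (by positivity)) (hc i).le
  have hg0 : 0 < g := by
    have : 0 ≤ ∑ i, ‖Q i‖ * (‖φ N‖ + ρ) / c i := Finset.sum_nonneg fun i _ => hterm i
    linarith
  have hgi : ∀ i, ‖Q i‖ * (‖φ N‖ + ρ) ≤ g * c i := fun i => by
    have := Finset.single_le_sum (f := fun i => ‖Q i‖ * (‖φ N‖ + ρ) / c i)
      (fun i _ => hterm i) (Finset.mem_univ i)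
    rw [← div_le_iff₀ (hc i)]
    linarith
  have hρ0 : 0 ≤ ρ := by linarith
  have hup : ∀ i x, inner ℝ (Q i x) x ≤ ‖Q i‖ * ‖x‖ ^ 2 := fun i x => by
    calc inner ℝ (Q i x) x ≤ ‖Q i x‖ * ‖x‖ := real_inner_le_norm _ _
      _ ≤ ‖Q i‖ * ‖x‖ * ‖x‖ := by gcongr; exact (Q i).le_opNorm x
      _ = _ := by ring
  refine ⟨g, hg0, C ^ 2, one_le_pow₀ hC1, ?_⟩
  intro σ hσ x hx
  refine chaining τD lam ρ C hτ hC1 (by linarith) ?_ σ hσ x ?_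
  · have e : -ρ * τD = -lam * τD + - Real.log C := by
      rw [hρ]; field_simp; ring
    rw [e, Real.exp_add, Real.exp_neg, Real.exp_log (by linarith)]
    apply le_of_eq
    field_simp
  · intro a b ha hab hcon
    set i := σ a with hi
    have hd := decay_interval (Q i) (φ N + g • φ (M i)) ρ (hsymm i) ?_ x a b hab ?_ ?_
    · have h1 := hlow i (x b)
      have h2 := hup i (x a)
      have h3 : ‖x b‖ ^ 2 ≤ (C * Real.exp (-ρ * (b - a)) * ‖x a‖) ^ 2 := by
        have e : Real.exp (-(2 * ρ * (b - a))) = Real.exp (-ρ * (b - a)) ^ 2 := by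
          rw [← Real.exp_nat_mul]; congr 1; push_cast; ring
        rw [e] at hd
        have h4 : ‖Q i‖ ≤ C ^ 2 := (hQC i).trans (by nlinarith)
        calc ‖x b‖ ^ 2 ≤ Real.exp (-ρ * (b - a)) ^ 2 * (‖Q i‖ * ‖x a‖ ^ 2) :=
              h1.trans (hd.trans (by gcongr))
          _ ≤ Real.exp (-ρ * (b - a)) ^ 2 * (C ^ 2 * ‖x a‖ ^ 2) := by gcongr
          _ = _ := by ring
      exact le_of_sq_le_sq h3 (by positivity)
    · intro y
      have e : (φ N + g • φ (M i)) y = φ N y + g • φ (M i) y := rfl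
      rw [e, inner_add_right, inner_smul_right]
      have h1 : inner ℝ (Q i y) (φ N y) ≤ ‖Q i‖ * ‖φ N‖ * ‖y‖ ^ 2 := by
        calc inner ℝ (Q i y) (φ N y) ≤ ‖Q i y‖ * ‖φ N y‖ := real_inner_le_norm _ _
          _ ≤ (‖Q i‖ * ‖y‖) * (‖φ N‖ * ‖y‖) := by
              gcongr
              · exact (Q i).le_opNorm y
              · exact (φ N).le_opNorm y
          _ = _ := by ring
      have h2 := mul_le_mul_of_nonneg_left (hneg i y) hg0.le
      have h3 := mul_le_mul_of_nonneg_left (hup i y) hρ0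
      have h4 := mul_le_mul_of_nonneg_right (hgi i) (sq_nonneg ‖y‖)
      linarith
    · intro t ht
      exact ((hx t (ha.trans ht.1)).continuousWithinAt).mono
        fun u hu => ha.trans hu.1
    · intro t ht
      have ht0 : 0 < t := ha.trans_lt ht.1
      have h1 := (hx t ht0.le).hasDerivAt (Ici_mem_nhds ht0)
      rw [hcon t ⟨ht.1.le, ht.2⟩] at h1
      exact h1
end

section
/- Let P = {1,…,p} be a finite index set, let M(1), …, M(p) be real n×n matrices each of which is exponentially stable (Hurwitz), and let N be a fixed real n×n matrix. Then for every average dwell time τ_D > 0, every chatter bound N₀ > 0, and every preassigned convergence rate λ > 0, there exist a positive number g and a constant c' ≥ 1 such that for every piecewise-constant switching signal σ : [0,∞) → P whose number of discontinuities in any open interval (τ, t) is at most N₀ + (t − τ)/τ_D, every differentiable function x : [0,∞) → ℝⁿ satisfying ẋ(t) = ( N + g M(σ(t)) ) x(t) for all t ≥ 0 obeys ‖x(t)‖ ≤ c' e^{−λ t} ‖x(0)‖ for all t ≥ 0. -/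
open Set Filter Matrix

/-- `σ` is a piecewise-constant switching signal with average dwell time `τD` and chatter
bound `N₀`: the number of its discontinuities in any open interval `(τ, t)` is at most
`N₀ + (t - τ) / τD`. -/
def HasAvgDwellTime {P : Type*} (τD N₀ : ℝ) (σ : ℝ → P) : Prop :=
  PiecewiseConstant σ ∧ ∀ τ t : ℝ, 0 ≤ τ → τ ≤ t →
    ((Discont σ ∩ Set.Ioo τ t).ncard : ℝ) ≤ N₀ + (t - τ) / τD

open scoped Topology ENNReal NNReal

lemma pow_tendsto_zero_aux {A : Type*} [NormedRing A] [NormedAlgebra ℂ A] [CompleteSpace A]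
    (a : A) (h : spectralRadius ℂ a < 1) : Tendsto (fun k : ℕ => a ^ k) atTop (𝓝 0) := by
  obtain ⟨r, h1, h2⟩ := exists_between h
  have hr : r ≠ ∞ := (h2.trans ENNReal.one_lt_top).ne
  lift r to ℝ≥0 using hr
  have hr1 : (r : ℝ) < 1 := by exact_mod_cast h2
  have h3 := (spectrum.pow_nnnorm_pow_one_div_tendsto_nhds_spectralRadius a).eventually_lt_const h1
  refine squeeze_zero_norm' (a := fun k : ℕ => (r : ℝ) ^ k) ?_
    (tendsto_pow_atTop_nhds_zero_of_lt_one r.2 hr1)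
  filter_upwards [h3, eventually_gt_atTop 0] with k hk hk0
  have hk0' : (0 : ℝ) < k := by exact_mod_cast hk0
  have h4 : (‖a ^ k‖₊ : ℝ≥0∞) ≤ (r : ℝ≥0∞) ^ k := by
    have := ENNReal.rpow_le_rpow hk.le hk0'.le
    rw [← ENNReal.rpow_mul, one_div, inv_mul_cancel₀ hk0'.ne', ENNReal.rpow_one,
      ENNReal.rpow_natCast] at this
    exact this
  have h5 : ‖a ^ k‖₊ ≤ r ^ k := by exact_mod_cast h4
  exact_mod_cast h5

section
attribute [local instance] Matrix.linftyOpNormedRing Matrix.linftyOpNormedAlgebra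

lemma cpow_tendsto_zero_aux {n : ℕ} (hn : n ≠ 0) (a : Matrix (Fin n) (Fin n) ℂ)
    (h : ∀ μ ∈ spectrum ℂ a, ‖μ‖ < 1) :
    ∀ i j, Tendsto (fun k : ℕ => (a ^ k) i j) atTop (𝓝 0) := by
  have : Nonempty (Fin n) := ⟨⟨0, Nat.pos_of_ne_zero hn⟩⟩
  have h1 : spectralRadius ℂ a < ((1 : ℝ≥0) : ℝ≥0∞) := by
    apply spectrum.spectralRadius_lt_of_forall_lt
    intro μ hμ
    exact_mod_cast h μ hμ
  have h2 := pow_tendsto_zero_aux a (by simpa using h1)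
  intro i j
  have h3 : Continuous fun m : Matrix (Fin n) (Fin n) ℂ => m i j :=
    continuous_id.matrix_elem i j
  exact (h3.tendsto 0).comp h2
end

lemma rpow_tendsto_zero_aux {n : ℕ} (B : Matrix (Fin n) (Fin n) ℝ)
    (h : ∀ μ ∈ spectrum ℂ (B.map (algebraMap ℝ ℂ)), ‖μ‖ < 1) :
    Tendsto (fun k : ℕ => Matrix.toEuclideanCLM (n := Fin n) (𝕜 := ℝ) (B ^ k)) atTop (𝓝 0) := by
  have hc : Continuous (Matrix.toEuclideanCLM (n := Fin n) (𝕜 := ℝ)) :=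
    LinearMap.continuous_of_finiteDimensional
      (Matrix.toEuclideanCLM (n := Fin n) (𝕜 := ℝ)).toAlgEquiv.toLinearMap
  rcases eq_or_ne n 0 with rfl | hn
  · have : ∀ k, B ^ k = 0 := fun k => Subsingleton.elim _ _
    simp [this]
  have h1 : Tendsto (fun k : ℕ => B ^ k) atTop (𝓝 0) := by
    refine tendsto_pi_nhds.2 fun i => tendsto_pi_nhds.2 fun j => ?_
    have := (Complex.continuous_re.tendsto 0).comp (cpow_tendsto_zero_aux hn _ h i j)
    refine (this.congr fun k => ?_).trans (by simp)
    have e : B.map (algebraMap ℝ ℂ) ^ k = (B ^ k).map (algebraMap ℝ ℂ) :=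
      (Matrix.map_pow B (algebraMap ℝ ℂ) k).symm
    simp only [Function.comp_apply, e]
    rfl
  have := (hc.tendsto 0).comp h1
  rw [map_zero] at this
  exact this

lemma exists_step_aux {n : ℕ} (A : Matrix (Fin n) (Fin n) ℝ) (hA : Hurwitz A) :
    ∃ h > (0 : ℝ), ∀ μ ∈ spectrum ℂ ((1 + h • A).map (algebraMap ℝ ℂ)), ‖μ‖ < 1 := by
  have hfin : (spectrum ℂ (A.map (algebraMap ℝ ℂ))).Finite := Matrix.finite_spectrum _
  have h1 : ∀ᶠ h : ℝ in 𝓝[>] 0, ∀ μ ∈ spectrum ℂ (A.map (algebraMap ℝ ℂ)),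
      ‖1 + (h : ℂ) * μ‖ < 1 := by
    rw [hfin.eventually_all]
    intro μ hμ
    have hre := hA μ hμ
    have h2 : ∀ᶠ h : ℝ in 𝓝[>] 0, 2 * μ.re + h * ‖μ‖ ^ 2 < 0 := by
      have : Continuous fun h : ℝ => 2 * μ.re + h * ‖μ‖ ^ 2 := by fun_prop
      exact ((this.tendsto 0).mono_left nhdsWithin_le_nhds).eventually_lt_const (by simp; linarith)
    filter_upwards [h2, self_mem_nhdsWithin] with h h3 (h4 : 0 < h)
    have : ‖1 + (h : ℂ) * μ‖ ^ 2 < 1 := by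
      rw [← Complex.normSq_eq_norm_sq, Complex.normSq_apply] at *
      simp at *
      nlinarith
    nlinarith [norm_nonneg (1 + (h : ℂ) * μ)]
  obtain ⟨h, h2, h3 : 0 < h⟩ := (h1.and self_mem_nhdsWithin).exists
  refine ⟨h, h3, fun μ hμ => ?_⟩
  have hh : (h : ℂ) ≠ 0 := by exact_mod_cast h3.ne'
  have e : (1 + h • A).map (algebraMap ℝ ℂ) =
      algebraMap ℂ _ 1 + (Units.mk0 (h : ℂ) hh) • A.map (algebraMap ℝ ℂ) := by
    ext i j
    rcases eq_or_ne i j with rfl | hij <;> simp [Units.smul_def, *]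
  have e2 : μ = (Units.mk0 (h : ℂ) hh) • ((h : ℂ)⁻¹ * (μ - 1)) + 1 := by
    simp [Units.smul_def]
    field_simp
    ring
  rw [e, e2, spectrum.add_mem_add_iff, spectrum.smul_mem_smul_iff] at hμ
  have := h2 _ hμ
  convert! this using 2
  field_simp
  ring

/-- A quadratic Lyapunov function for a Hurwitz matrix. -/
lemma lyapunov_aux {n : ℕ} (A : Matrix (Fin n) (Fin n) ℝ) (hA : Hurwitz A) :
    ∃ P : EuclideanSpace ℝ (Fin n) →L[ℝ] EuclideanSpace ℝ (Fin n),
      (∀ x y, (inner ℝ (P x) y) = (inner ℝ (P y) x)) ∧ (∀ x, ‖x‖ ^ 2 ≤ (inner ℝ (P x) x)) ∧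
      ∀ x, (inner ℝ (P x) (Matrix.toEuclideanLin A x)) ≤ - ‖x‖ ^ 2 := by
  obtain ⟨h, h0, hB⟩ := exists_step_aux A hA
  have hT := rpow_tendsto_zero_aux _ hB
  set B := Matrix.toEuclideanCLM (n := Fin n) (𝕜 := ℝ) (1 + h • A) with hBdef
  have hBx : ∀ x, B x = x + h • Matrix.toEuclideanLin A x := by
    intro x
    simp only [hBdef, map_add, map_one, map_smul]
    rfl
  simp only [map_pow] at hT
  have h1 : ∀ᶠ k : ℕ in atTop, ‖B ^ k‖ < 1 / 2 := by
    have := hT.norm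
    rw [norm_zero] at this
    exact this.eventually_lt_const (by norm_num)
  obtain ⟨k, hk, hk1⟩ := (h1.and (eventually_ge_atTop 1)).exists
  set W : EuclideanSpace ℝ (Fin n) → EuclideanSpace ℝ (Fin n) → ℝ :=
    fun x y => ∑ j ∈ Finset.range k, (inner ℝ ((B ^ j) x) ((B ^ j) y)) with hW
  have hWs : ∀ x y, W x y = W y x := fun x y =>
    Finset.sum_congr rfl fun j _ => real_inner_comm _ _
  have hWn : ∀ x, 0 ≤ W x x := fun x => Finset.sum_nonneg fun j _ => real_inner_self_nonneg
  have hWl : ∀ x, ‖x‖ ^ 2 ≤ W x x := by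
    intro x
    have := Finset.single_le_sum (f := fun j => (inner ℝ ((B ^ j) x) ((B ^ j) x)))
      (fun j _ => real_inner_self_nonneg) (Finset.mem_range.2 hk1)
    simpa [hW] using this
  have hWB : ∀ x, W (B x) (B x) - W x x = ‖(B ^ k) x‖ ^ 2 - ‖x‖ ^ 2 := by
    intro x
    have := Finset.sum_range_sub (fun j => (inner ℝ ((B ^ j) x) ((B ^ j) x))) k
    simp only [hW, ← Finset.sum_sub_distrib]
    rw [← real_inner_self_eq_norm_sq, ← real_inner_self_eq_norm_sq]
    simpa [pow_succ] using this
  have hWexp : ∀ x y, W (x + h • y) (x + h • y) = W x x + 2 * h * W x y + h ^ 2 * W y y := by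
    intro x y
    simp only [hW, Finset.mul_sum, ← Finset.sum_add_distrib]
    refine Finset.sum_congr rfl fun j _ => ?_
    simp only [map_add, map_smul, inner_add_left, inner_add_right, real_inner_smul_left,
      real_inner_smul_right]
    rw [real_inner_comm ((B ^ j) x) ((B ^ j) y)]
    ring
  have hWA : ∀ x, 2 * h * W x (Matrix.toEuclideanLin A x) ≤ - (3 / 4) * ‖x‖ ^ 2 := by
    intro x
    have e := hWB x
    rw [hBx, hWexp] at e
    have b : ‖(B ^ k) x‖ ≤ 1 / 2 * ‖x‖ := ((B ^ k).le_opNorm x).trans (by gcongr)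
    have b2 : ‖(B ^ k) x‖ ^ 2 ≤ (1 / 2 * ‖x‖) ^ 2 := by gcongr
    nlinarith [mul_nonneg (sq_nonneg h) (hWn (Matrix.toEuclideanLin A x))]
  set c : ℝ := 1 + 4 * h with hc
  set P := c • ∑ j ∈ Finset.range k, (ContinuousLinearMap.adjoint (B ^ j)).comp (B ^ j) with hP
  have hPW : ∀ x y, (inner ℝ (P x) y) = c * W x y := by
    intro x y
    simp only [hP, hW, _root_.smul_apply, _root_.sum_apply,
      real_inner_smul_left, sum_inner, ContinuousLinearMap.comp_apply,
      ContinuousLinearMap.adjoint_inner_left]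
  refine ⟨P, fun x y => by rw [hPW, hPW, hWs], fun x => ?_, fun x => ?_⟩
  · rw [hPW]
    nlinarith [hWl x, hWn x]
  · rw [hPW]
    have := hWA x
    have h5 : W x (Matrix.toEuclideanLin A x) ≤ 0 := by
      by_contra hcon
      push Not at hcon
      nlinarith [mul_pos h0 hcon, sq_nonneg ‖x‖]
    nlinarith [sq_nonneg ‖x‖]

lemma interval_aux {n : ℕ} (P : EuclideanSpace ℝ (Fin n) →L[ℝ] EuclideanSpace ℝ (Fin n))
    (hs : ∀ x y, (inner ℝ (P x) y) = (inner ℝ (P y) x)) (κ a b : ℝ) (ha : 0 ≤ a)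
    (x D : ℝ → EuclideanSpace ℝ (Fin n))
    (hx : ∀ t ∈ Set.Ici (0 : ℝ), HasDerivWithinAt x (D t) (Set.Ici 0) t)
    (hD : ∀ t ∈ Set.Ioo a b, (inner ℝ (P (x t)) (D t)) ≤ - κ * (inner ℝ (P (x t)) (x t))) :
    ∀ t ∈ Set.Icc a b, Real.exp (2 * κ * t) * (inner ℝ (P (x t)) (x t)) ≤
      Real.exp (2 * κ * a) * (inner ℝ (P (x a)) (x a)) := by
  have hd : ∀ t ∈ Set.Ioo a b, HasDerivAt (fun t => Real.exp (2 * κ * t) * (inner ℝ (P (x t)) (x t)))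
      (Real.exp (2 * κ * t) * (2 * κ) * (inner ℝ (P (x t)) (x t)) +
        Real.exp (2 * κ * t) * ((inner ℝ (P (x t)) (D t)) + (inner ℝ (P (D t)) (x t)))) t := by
    intro t ht
    have ht0 : 0 < t := ha.trans_lt ht.1
    have h1 : HasDerivAt x (D t) t := (hx t ht0.le).hasDerivAt (Ici_mem_nhds ht0)
    have h2 : HasDerivAt (fun t => P (x t)) (P (D t)) t := P.hasFDerivAt.comp_hasDerivAt t h1
    have h3 : HasDerivAt (fun t => Real.exp (2 * κ * t)) (Real.exp (2 * κ * t) * (2 * κ)) t := by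
      have := ((hasDerivAt_id t).const_mul (2 * κ)).exp
      simpa using this
    exact h3.mul (h2.inner ℝ h1)
  have hc : ContinuousOn (fun t => Real.exp (2 * κ * t) * (inner ℝ (P (x t)) (x t))) (Set.Icc a b) := by
    have h1 : ContinuousOn x (Set.Icc a b) := fun t ht =>
      (hx t (ha.trans ht.1)).continuousWithinAt.mono fun s hs => ha.trans hs.1
    have h2 : ContinuousOn (fun t => P (x t)) (Set.Icc a b) := P.continuous.comp_continuousOn h1
    exact (Continuous.continuousOn (by fun_prop)).mul (h2.inner h1)
  have hanti := antitoneOn_of_deriv_nonpos (convex_Icc a b) hc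
    (by
      rw [interior_Icc]
      exact fun t ht => (hd t ht).differentiableAt.differentiableWithinAt)
    (by
      rw [interior_Icc]
      intro t ht
      rw [(hd t ht).deriv, hs (D t)]
      nlinarith [hD t ht, Real.exp_pos (2 * κ * t)])
  intro t ht
  exact hanti ⟨le_rfl, ht.1.trans ht.2⟩ ht ht.1

lemma discont_finite_aux {P : Type*} (σ : ℝ → P) (T : ℕ → ℝ) (h0 : T 0 = 0) (hmono : StrictMono T)
    (htop : Tendsto T atTop atTop)
    (hσ : ∀ k : ℕ, ∀ s ∈ Set.Ico (T k) (T (k + 1)), σ s = σ (T k)) (b : ℝ) :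
    (Discont σ ∩ Set.Ioo 0 b).Finite := by
  obtain ⟨k, hk⟩ := (htop.eventually_ge_atTop b).exists
  refine ((Set.finite_Iio k).image T).subset ?_
  rintro s ⟨hs, hs0, hsb⟩
  have hex : ∃ m, s < T m := ⟨k, hsb.trans_le hk⟩
  classical
  obtain ⟨j, hj⟩ : ∃ j, Nat.find hex = j + 1 := by
    refine Nat.exists_eq_succ_of_ne_zero fun h => ?_
    have := Nat.find_spec hex
    rw [h, h0] at this
    linarith
  have h1 : s < T (j + 1) := hj ▸ Nat.find_spec hex
  have h2 : T j ≤ s := not_lt.1 (Nat.find_min hex (by omega))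
  rcases h2.eq_or_lt with h3 | h3
  · exact ⟨j, hmono.lt_iff_lt.1 (h3.trans_lt (hsb.trans_le hk)), h3⟩
  · refine absurd ?_ hs
    filter_upwards [Ioo_mem_nhds h3 h1] with u hu
    rw [hσ j u ⟨hu.1.le, hu.2⟩, hσ j s ⟨h2, h1⟩]

/-- Lemma 4: average-dwell-time switching of a high-gain Hurwitz family perturbed by a
fixed matrix `N`: for any `τD > 0`, `N₀ > 0` and `λ > 0` there is a gain `g > 0` such that
all solutions of `ẋ = (N + g M(σ(t))) x` decay at rate `λ`. -/
theorem lemma4_avg_dwell_time_high_gain_perturbed_stability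
    {n p : ℕ} (hp : 1 ≤ p) (M : Fin p → Matrix (Fin n) (Fin n) ℝ)
    (hM : ∀ i, Hurwitz (M i)) (N : Matrix (Fin n) (Fin n) ℝ) :
    ∀ τD > (0 : ℝ), ∀ N₀ > (0 : ℝ), ∀ lam > (0 : ℝ), ∃ g > (0 : ℝ), ∃ c' ≥ (1 : ℝ),
      ∀ σ : ℝ → Fin p, HasAvgDwellTime τD N₀ σ →
        ∀ x : ℝ → EuclideanSpace ℝ (Fin n),
          (∀ t ∈ Set.Ici (0 : ℝ),
            HasDerivWithinAt x
              (Matrix.toEuclideanLin N (x t) + g • Matrix.toEuclideanLin (M (σ t)) (x t))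
              (Set.Ici 0) t) →
          ∀ t ≥ (0 : ℝ), ‖x t‖ ≤ c' * Real.exp (-lam * t) * ‖x 0‖ := by
  intro τD hτ N₀ hN₀ lam hlam
  choose P hPs hPl hPA using fun i => lyapunov_aux (M i) (hM i)
  obtain ⟨β, hβ⟩ : ∃ r : ℝ, r = 1 + ∑ i, ‖P i‖ := ⟨_, rfl⟩
  have hβ1 : 1 ≤ β := by
    have : 0 ≤ ∑ i, ‖P i‖ := Finset.sum_nonneg fun i _ => norm_nonneg _
    linarith
  have hβ0 : 0 < β := by linarith
  have hPβ : ∀ i, ‖P i‖ ≤ β := by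
    intro i
    have := Finset.single_le_sum (f := fun i => ‖P i‖) (fun i _ => norm_nonneg _)
      (Finset.mem_univ i)
    linarith
  have hin : ∀ i x y, (inner ℝ (P i x) y) ≤ β * ‖x‖ * ‖y‖ := by
    intro i x y
    refine (real_inner_le_norm _ _).trans ?_
    gcongr
    exact ((P i).le_opNorm x).trans (by gcongr; exact hPβ i)
  have hPu : ∀ i x, (inner ℝ (P i x) x) ≤ β * ‖x‖ ^ 2 := fun i x => (hin i x x).trans (by rw [sq, mul_assoc])
  obtain ⟨ν, hν⟩ : ∃ r : ℝ, r = ‖Matrix.toEuclideanCLM (n := Fin n) (𝕜 := ℝ) N‖ := ⟨_, rfl⟩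
  have hν0 : 0 ≤ ν := hν ▸ norm_nonneg _
  have hN : ∀ x, ‖Matrix.toEuclideanLin N x‖ ≤ ν * ‖x‖ := fun x => hν ▸
    (Matrix.toEuclideanCLM (n := Fin n) (𝕜 := ℝ) N).le_opNorm x
  have hlog : 0 ≤ Real.log β := Real.log_nonneg hβ1
  obtain ⟨κ, hκ⟩ : ∃ r : ℝ, r = lam + Real.log β / (2 * τD) := ⟨_, rfl⟩
  have hκ0 : 0 < κ := by
    have : 0 ≤ Real.log β / (2 * τD) := div_nonneg hlog (by linarith)
    linarith
  obtain ⟨g, hg⟩ : ∃ r : ℝ, r = β * ν + κ * β := ⟨_, rfl⟩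
  have hg0 : 0 < g := hg ▸ add_pos_of_nonneg_of_pos (mul_nonneg hβ0.le hν0) (mul_pos hκ0 hβ0)
  obtain ⟨c', hc'⟩ : ∃ r : ℝ, r = β * Real.exp (Real.log β * (N₀ + 1 / τD)) := ⟨_, rfl⟩
  have hc'1 : 1 ≤ c' := hc' ▸ one_le_mul_of_one_le_of_one_le hβ1
    (Real.one_le_exp (mul_nonneg hlog (add_nonneg hN₀.le (div_nonneg zero_le_one hτ.le))))
  refine ⟨g, hg0, c', hc'1, ?_⟩
  rintro σ ⟨⟨T, hT0, hTm, hTt, hσ⟩, hcount⟩ x hx t ht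
  have hfin := discont_finite_aux σ T hT0 hTm hTt hσ
  have hTn : ∀ k, 0 ≤ T k := fun k => hT0 ▸ hTm.monotone (Nat.zero_le k)
  -- decay inequality of the Lyapunov functions
  have hdec : ∀ i (y : EuclideanSpace ℝ (Fin n)),
      (inner ℝ (P i y) (Matrix.toEuclideanLin N y + g • Matrix.toEuclideanLin (M i) y)) ≤
        - κ * (inner ℝ (P i y) y) := by
    intro i y
    rw [inner_add_right, real_inner_smul_right]
    have h1 := hin i y (Matrix.toEuclideanLin N y)
    have h2 : β * ‖y‖ * ‖Matrix.toEuclideanLin N y‖ ≤ β * ‖y‖ * (ν * ‖y‖) := by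
      gcongr
      exact hN y
    have h3 := mul_le_mul_of_nonneg_left (hPA i y) hg0.le
    have h4 := mul_le_mul_of_nonneg_left (hPu i y) hκ0.le
    rw [hg] at h3 ⊢
    nlinarith
  have hint : ∀ k, ∀ s ∈ Set.Icc (T k) (T (k + 1)),
      Real.exp (2 * κ * s) * (inner ℝ (P (σ (T k)) (x s)) (x s)) ≤
        Real.exp (2 * κ * T k) * (inner ℝ (P (σ (T k)) (x (T k))) (x (T k))) := by
    intro k
    refine interval_aux (P (σ (T k))) (hPs _) κ _ _ (hTn k) x _ hx ?_
    intro s hs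
    rw [hσ k s ⟨hs.1.le, hs.2⟩]
    exact hdec _ _
  -- number of switches up to time `T k`
  have hfin' : ∀ b, (Discont σ ∩ Set.Ioc 0 b).Finite := fun b =>
    (hfin (b + 1)).subset fun s hs => ⟨hs.1, hs.2.1, hs.2.2.trans_lt (by linarith)⟩
  have hind : ∀ k, Real.exp (2 * κ * T k) * (inner ℝ (P (σ (T k)) (x (T k))) (x (T k))) ≤
      β ^ (Discont σ ∩ Set.Ioc 0 (T k)).ncard * (β * ‖x 0‖ ^ 2) := by
    intro k
    induction k with
    | zero => simpa [hT0] using hPu (σ 0) (x 0)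
    | succ k ih =>
      have hlt : T k < T (k + 1) := hTm (Nat.lt_succ_self k)
      have h1 := (hint k (T (k + 1)) ⟨hlt.le, le_rfl⟩).trans ih
      have hsub : Discont σ ∩ Set.Ioc 0 (T k) ⊆ Discont σ ∩ Set.Ioc 0 (T (k + 1)) :=
        fun s hs => ⟨hs.1, hs.2.1, hs.2.2.trans hlt.le⟩
      by_cases hd : T (k + 1) ∈ Discont σ
      · have h2 : (Discont σ ∩ Set.Ioc 0 (T k)).ncard + 1 ≤
            (Discont σ ∩ Set.Ioc 0 (T (k + 1))).ncard := by
          rw [← Set.ncard_insert_of_notMem (a := T (k + 1)) (fun h => absurd h.2.2 (not_le.2 hlt))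
            (hfin' _)]
          exact Set.ncard_le_ncard
            (Set.insert_subset ⟨hd, (hTn k).trans_lt hlt, le_rfl⟩ hsub) (hfin' _)
        have h3 : (inner ℝ (P (σ (T (k + 1))) (x (T (k + 1)))) (x (T (k + 1)))) ≤
            β * (inner ℝ (P (σ (T k)) (x (T (k + 1)))) (x (T (k + 1)))) :=
          (hPu _ _).trans (by gcongr; exact hPl _ _)
        calc Real.exp (2 * κ * T (k + 1)) * (inner ℝ (P (σ (T (k + 1))) (x (T (k + 1)))) (x (T (k + 1))))
            ≤ Real.exp (2 * κ * T (k + 1)) *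
                (β * (inner ℝ (P (σ (T k)) (x (T (k + 1)))) (x (T (k + 1))))) := by gcongr
          _ = β * (Real.exp (2 * κ * T (k + 1)) *
                (inner ℝ (P (σ (T k)) (x (T (k + 1)))) (x (T (k + 1))))) := by ring
          _ ≤ β * (β ^ (Discont σ ∩ Set.Ioc 0 (T k)).ncard * (β * ‖x 0‖ ^ 2)) := by gcongr
          _ = β ^ ((Discont σ ∩ Set.Ioc 0 (T k)).ncard + 1) * (β * ‖x 0‖ ^ 2) := by ring
          _ ≤ _ := by gcongr
      · have hev : ∀ᶠ u in 𝓝 (T (k + 1)), σ u = σ (T (k + 1)) := not_not.1 hd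
        have hev2 : ∀ᶠ u in 𝓝[<] (T (k + 1)), σ u = σ (T (k + 1)) :=
          hev.filter_mono nhdsWithin_le_nhds
        obtain ⟨u, hu1, hu2⟩ := (hev2.and (Ioo_mem_nhdsLT hlt)).exists
        have he : σ (T (k + 1)) = σ (T k) := by rw [← hu1, hσ k u ⟨hu2.1.le, hu2.2⟩]
        rw [he]
        refine h1.trans ?_
        gcongr
        exact hfin' _
  -- locate `t`
  obtain ⟨k, hk1, hk2⟩ : ∃ k, T k ≤ t ∧ t < T (k + 1) := by
    have hex : ∃ m, t < T m := (hTt.eventually_gt_atTop t).exists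
    classical
    obtain ⟨j, hj⟩ : ∃ j, Nat.find hex = j + 1 := by
      refine Nat.exists_eq_succ_of_ne_zero fun h => ?_
      have := Nat.find_spec hex
      rw [h, hT0] at this
      linarith
    exact ⟨j, not_lt.1 (Nat.find_min hex (by omega)), hj ▸ Nat.find_spec hex⟩
  have hcnt : ((Discont σ ∩ Set.Ioc 0 (T k)).ncard : ℝ) ≤ N₀ + (t + 1) / τD := by
    have h1 := hcount 0 (t + 1) le_rfl (by linarith)
    have h2 : (Discont σ ∩ Set.Ioc 0 (T k)).ncard ≤ (Discont σ ∩ Set.Ioo 0 (t + 1)).ncard :=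
      Set.ncard_le_ncard (fun s hs => ⟨hs.1, hs.2.1, by linarith [hs.2.2]⟩) (hfin _)
    have h3 : ((Discont σ ∩ Set.Ioc 0 (T k)).ncard : ℝ) ≤
      (Discont σ ∩ Set.Ioo 0 (t + 1)).ncard := by exact_mod_cast h2
    rw [sub_zero] at h1
    linarith
  have hpow : β ^ (Discont σ ∩ Set.Ioc 0 (T k)).ncard ≤
      Real.exp (Real.log β * (N₀ + (t + 1) / τD)) := by
    rw [← Real.rpow_natCast, Real.rpow_def_of_pos hβ0]
    gcongr
  have hmain : Real.exp (2 * κ * t) * ‖x t‖ ^ 2 ≤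
      Real.exp (Real.log β * (N₀ + (t + 1) / τD)) * (β * ‖x 0‖ ^ 2) := by
    refine le_trans ?_ ((hint k t ⟨hk1, hk2.le⟩).trans ((hind k).trans ?_))
    · gcongr
      exact hPl _ _
    · gcongr
  have hfinal : ‖x t‖ ^ 2 ≤ c' * Real.exp (-lam * t) ^ 2 * ‖x 0‖ ^ 2 := by
    have e1 : Real.exp (Real.log β * (N₀ + (t + 1) / τD)) * β =
        Real.exp (2 * κ * t) * (c' * Real.exp (-lam * t) ^ 2) := by
      have : Real.exp (Real.log β * (N₀ + (t + 1) / τD)) = Real.exp (2 * κ * t) *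
          (Real.exp (Real.log β * (N₀ + 1 / τD)) * Real.exp (-lam * t) ^ 2) := by
        rw [← Real.exp_nat_mul, ← Real.exp_add, ← Real.exp_add]
        congr 1
        rw [hκ]
        push_cast
        field_simp
        ring
      rw [this, hc']
      ring
    rw [← mul_assoc, e1, mul_assoc (Real.exp (2 * κ * t))] at hmain
    exact le_of_mul_le_mul_left hmain (Real.exp_pos _)
  refine le_of_sq_le_sq ?_ (by positivity)
  refine hfinal.trans ?_
  rw [mul_pow, mul_pow]
  gcongr
  nlinarith
end
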